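/- arXiv:1807.01895 — 3 statements merged into one kernel-verified Lean document; each statement's English description precedes it below -/
import Mathlib

section
/- Let p ∈ βℕ \ ℕ, let Z = ℕ ∪ {p} with the subspace topology from the Stone–Čech compactification βℕ of the discrete space ℕ, and let X = Z^ℕ with the product topology. Then X is a Baire space. -/
open Filter Topology Set TopologicalSpace

universe u

/-- A zero-set: the preimage of `{0}` under some continuous real-valued function. -/
def IsZeroSet {X : Type u} [TopologicalSpace X] (Z : Set X) : Prop :=
  ∃ g : X → ℝ, Continuous g ∧ Z = g ⁻¹' {0}

/-- A cozero-set: the complement of a zero-set. -/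
def IsCozeroSet {X : Type u} [TopologicalSpace X] (U : Set X) : Prop :=
  IsZeroSet Uᶜ

/-- A Zσ-set: a countable union of zero-sets. -/
def IsZSigmaSet {X : Type u} [TopologicalSpace X] (D : Set X) : Prop :=
  ∃ Z : ℕ → Set X, (∀ n, IsZeroSet (Z n)) ∧ D = ⋃ n, Z n

/-- An Fσ-set: a countable union of closed sets. -/
def IsFSigmaSet {Y : Type u} [TopologicalSpace Y] (S : Set Y) : Prop :=
  ∃ F : ℕ → Set Y, (∀ n, IsClosed (F n)) ∧ S = ⋃ n, F n

/-- `g : ℕ → X → ℝ` converges pointwise to `f : X → ℝ`. -/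
def PointwiseLimit {X : Type u} (g : ℕ → X → ℝ) (f : X → ℝ) : Prop :=
  ∀ x, Tendsto (fun n => g n x) atTop (𝓝 (f x))

/-- `USC^f(X)`: real-valued functions all of whose strict sublevel sets are cozero-sets. -/
def USCf (X : Type u) [TopologicalSpace X] : Set (X → ℝ) :=
  {f | ∀ r : ℝ, IsCozeroSet {x | f x < r}}

/-- `USC(X)`: upper semicontinuous real-valued functions (strict sublevel sets open). -/
def USC (X : Type u) [TopologicalSpace X] : Set (X → ℝ) :=
  {f | ∀ r : ℝ, IsOpen {x | f x < r}}

/-- `B₁(X)`: Baire class one functions, i.e. pointwise limits of sequences of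
continuous real-valued functions. -/
def B1 (X : Type u) [TopologicalSpace X] : Set (X → ℝ) :=
  {f | ∃ g : ℕ → X → ℝ, (∀ n, Continuous (g n)) ∧ PointwiseLimit g f}

/-- A family `F` of real-valued functions on `X` is sequentially separable (for the
topology of pointwise convergence): there is a countable `S ⊆ F` such that every
member of `F` is a pointwise limit of a sequence from `S`. -/
def SeqSeparable {X : Type u} (F : Set (X → ℝ)) : Prop :=
  ∃ S : Set (X → ℝ), S ⊆ F ∧ S.Countable ∧
    ∀ f ∈ F, ∃ g : ℕ → X → ℝ, (∀ n, g n ∈ S) ∧ PointwiseLimit g f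

/-- Property `U`: there is a continuous bijection (condensation) from `X` onto a
separable metrizable space `Y` carrying every zero-set of `X` to an Fσ-set of `Y`. -/
def PropertyU (X : Type u) [TopologicalSpace X] : Prop :=
  ∃ (Y : Type u) (_ : TopologicalSpace Y), MetrizableSpace Y ∧ SeparableSpace Y ∧
    ∃ f : X → Y, Continuous f ∧ Function.Bijective f ∧
      ∀ D : Set X, IsZeroSet D → IsFSigmaSet (f '' D)

/-- A space containing a dense inducing copy of a Baire space is a Baire space. -/
theorem IsDenseInducing.baireSpace {Y X : Type*} [TopologicalSpace Y] [TopologicalSpace X]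
    [BaireSpace Y] {f : Y → X} (hf : IsDenseInducing f) : BaireSpace X where
  baire_property U hUo hUd := by
    have h : Dense (⋂ n, f ⁻¹' U n) := by
      refine dense_iInter_of_isOpen (fun n => (hUo n).preimage hf.continuous) fun n => ?_
      rw [dense_iff_inter_open]
      rintro V hV ⟨y, hy⟩
      obtain ⟨W, hW, rfl⟩ := hf.isInducing.isOpen_iff.1 hV
      obtain ⟨z, hz⟩ := hf.dense.exists_mem_open (hW.inter (hUo n))
        ((hUd n).inter_open_nonempty W hW ⟨f y, hy⟩)
      exact ⟨z, hz⟩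
    rw [← preimage_iInter] at h
    exact (hf.dense.dense_image hf.continuous h).mono (image_preimage_subset _ _)

/-- In a subspace of the Stone–Čech compactification containing the image of a completely regular
space, that image is dense and carries the original topology. -/
theorem isDenseInducing_codRestrict_stoneCechUnit {α : Type u} [TopologicalSpace α]
    [CompletelyRegularSpace α] {S : Set (StoneCech α)} (hS : ∀ a, stoneCechUnit a ∈ S) :
    IsDenseInducing (codRestrict stoneCechUnit S hS) where
  toIsInducing := isInducing_stoneCechUnit.codRestrict hS
  dense := by
    intro x
    rw [closure_subtype, ← range_comp]
    exact denseRange_stoneCechUnit x.1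

/-- For `Z = ℕ ∪ {p} ⊆ βℕ` (`p ∈ βℕ \ ℕ`), the space `X = Z^ℕ` is a Baire space. -/
theorem stmt17 (p : StoneCech ℕ) (hp : p ∉ Set.range (stoneCechUnit : ℕ → StoneCech ℕ)) :
    BaireSpace (ℕ → ↥(insert p (Set.range (stoneCechUnit : ℕ → StoneCech ℕ)))) := by
  have h := isDenseInducing_codRestrict_stoneCechUnit
    (fun n : ℕ => mem_insert_of_mem p (mem_range_self n))
  exact IsDenseInducing.baireSpace (f := Pi.map fun _ : ℕ => _)
    ⟨.piMap fun _ => h.isInducing, .piMap fun _ => h.dense⟩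
end

section
/- Let p ∈ βℕ \ ℕ, let Z = ℕ ∪ {p} with the subspace topology from the Stone–Čech compactification βℕ of the discrete space ℕ, and let X = Z^ℕ with the product topology. Then no nonempty open subset of X is metrizable (as a subspace of X). -/
open Filter Topology Set TopologicalSpace

universe u

/-- A sequence of natural numbers cannot converge in `βℕ` to a point outside `ℕ`. -/
theorem not_tendsto_stoneCechUnit {p : StoneCech ℕ}
    (hp : p ∉ Set.range (stoneCechUnit : ℕ → StoneCech ℕ)) (a : ℕ → ℕ) :
    ¬ Tendsto (fun n => stoneCechUnit (a n)) atTop (𝓝 p) := by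
  intro ha
  have ha' : Tendsto a atTop atTop := by
    refine Tendsto.mono_right ?_ Nat.cofinite_eq_atTop.le
    refine (le_cofinite_iff_eventually_ne (l := map a atTop)).2 fun m => ?_
    have hm : p ≠ stoneCechUnit m := fun h => hp ⟨m, h.symm⟩
    exact eventually_map.2 ((ha.eventually_ne hm).mono fun n hn hnm =>
      hn (congrArg stoneCechUnit hnm))
  obtain ⟨φ, hφ, hmono⟩ := strictMono_subseq_of_tendsto_atTop ha'
  classical
  let f : ℕ → Bool := fun m => decide (∃ k, a (φ (2 * k)) = m)
  have hf : Continuous f := continuous_of_discreteTopology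
  have hlim : Tendsto (fun n => f (a (φ n))) atTop (𝓝 (stoneCechExtend hf p)) := by
    have h := ((continuous_stoneCechExtend hf).tendsto p).comp (ha.comp hφ.tendsto_atTop)
    refine h.congr fun n => ?_
    simp [stoneCechExtend_stoneCechUnit]
  rw [nhds_discrete, tendsto_pure] at hlim
  obtain ⟨N, hN⟩ := eventually_atTop.1 hlim
  have heven : f (a (φ (2 * N))) = true := decide_eq_true ⟨N, rfl⟩
  have hodd : f (a (φ (2 * N + 1))) = false := by
    refine decide_eq_false ?_
    rintro ⟨k, hk⟩
    have := hmono.injective hk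
    omega
  have h := (hN (2 * N) (by omega)).trans (hN (2 * N + 1) (by omega)).symm
  rw [heven, hodd] at h
  exact Bool.noConfusion h

/-- The space `ℕ ∪ {p}` is not first countable when `p ∈ βℕ \ ℕ`. -/
theorem not_firstCountableTopology_insert_range_stoneCechUnit {p : StoneCech ℕ}
    (hp : p ∉ Set.range (stoneCechUnit : ℕ → StoneCech ℕ)) :
    ¬ FirstCountableTopology ↥(insert p (Set.range (stoneCechUnit : ℕ → StoneCech ℕ))) := by
  intro _
  let Z := ↥(insert p (Set.range (stoneCechUnit : ℕ → StoneCech ℕ)))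
  let q : Z := ⟨p, Set.mem_insert _ _⟩
  let S : Set Z := Subtype.val ⁻¹' Set.range (stoneCechUnit : ℕ → StoneCech ℕ)
  have hq : q ∈ closure S := by
    rw [closure_subtype, Subtype.image_preimage_coe,
      Set.inter_eq_self_of_subset_right (Set.subset_insert _ _),
      denseRange_stoneCechUnit.closure_range]
    trivial
  obtain ⟨y, hyS, hy⟩ := mem_closure_iff_seq_limit.1 hq
  choose a ha using hyS
  refine not_tendsto_stoneCechUnit hp a ?_
  simp only [ha]
  exact (continuous_subtype_val.tendsto q).comp hy

/-- For `Z = ℕ ∪ {p} ⊆ βℕ` (`p ∈ βℕ \ ℕ`) and `X = Z^ℕ`, no nonempty open subset of `X`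
is metrizable. -/
theorem stmt18 (p : StoneCech ℕ) (hp : p ∉ Set.range (stoneCechUnit : ℕ → StoneCech ℕ))
    (U : Set (ℕ → ↥(insert p (Set.range (stoneCechUnit : ℕ → StoneCech ℕ)))))
    (hU : IsOpen U) (hne : U.Nonempty) : ¬ MetrizableSpace ↥U := by
  intro _
  obtain ⟨x, hx⟩ := hne
  obtain ⟨I, V, hV, hVU⟩ := isOpen_pi_iff.1 hU x hx
  obtain ⟨j, hj⟩ := Infinite.exists_notMem_finset I
  have hmem : ∀ z, Function.update x j z ∈ U := fun z => hVU fun i hi => by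
    rw [Function.update_of_ne (ne_of_mem_of_not_mem (Finset.mem_coe.1 hi) hj)]
    exact (hV i hi).2
  have hcont : Continuous fun z => Function.update x j z := continuous_const.update j continuous_id
  have hemb : IsEmbedding fun z => (⟨Function.update x j z, hmem z⟩ : U) :=
    Function.LeftInverse.isEmbedding (f := fun u : U => u.1 j)
      (fun z => Function.update_self j z x)
      ((continuous_apply j).comp continuous_subtype_val)
      (hcont.subtype_mk hmem)
  exact not_firstCountableTopology_insert_range_stoneCechUnit hp
    hemb.isInducing.firstCountableTopology
end

section
/- Let X be a Tychonoff space. Then the space USC^f(X), endowed with the topology of pointwise convergence, is sequentially separable if and only if there exists a countable set S of continuous real-valued functions on X such that every function in B₁(X) is the pointwise limit of a sequence of elements of S. -/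
open Filter Topology Set TopologicalSpace

universe u

/-- A point of `B` that, among the points of `B`, follows the membership pattern of the sets
`C 0, …, C (n - 1)` greedily. -/
theorem exists_greedy_mem {α : Type*} (n : ℕ) (C : ℕ → Set α) (B : Set α) (hB : B.Nonempty) :
    ∃ p ∈ B, ∀ x ∈ B, ∀ M ≤ n, (∀ m < M, x ∉ C m → Disjoint B (C m)) →
      ∀ m < M, x ∈ C m → p ∈ C m := by
  induction n generalizing C B with
  | zero =>
    obtain ⟨p, hp⟩ := hB
    exact ⟨p, hp, fun x _ M hM _ m hm => by omega⟩
  | succ n ih =>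
    by_cases h0 : (B ∩ C 0).Nonempty
    · obtain ⟨p, hp, hpB⟩ := ih (fun m => C (m + 1)) _ h0
      refine ⟨p, hp.1, fun x hx M hM hC m hm hxm => ?_⟩
      have hx0 : x ∈ C 0 := by
        by_contra hx0
        exact h0.ne_empty (hC 0 (by omega) hx0).inter_eq
      cases m with
      | zero => exact hp.2
      | succ m =>
        refine hpB x ⟨hx, hx0⟩ (M - 1) (by omega) (fun k hk hxk => ?_) m (by omega) hxm
        exact (hC (k + 1) (by omega) hxk).mono_left inter_subset_left
    · obtain ⟨p, hp, hpB⟩ := ih (fun m => C (m + 1)) B hB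
      refine ⟨p, hp, fun x hx M hM hC m hm hxm => ?_⟩
      cases m with
      | zero => exact absurd ⟨x, hx, hxm⟩ h0
      | succ m =>
        exact hpB x hx (M - 1) (by omega) (fun k hk hxk => hC (k + 1) (by omega) hxk) m
          (by omega) hxm

/-- If the preimages under `f` of open sets are unions of members of a countable family of
closed sets pulled back along `G : X → K`, with `K` metrizable, then `f` is a pointwise limit of
continuous functions of `G`. -/
theorem exists_continuousMap_pointwiseLimit {X : Type u} {K : Type*} [TopologicalSpace K]
    [MetrizableSpace K] (G : X → K) (f : X → ℝ) {ι : Type*} [Countable ι] (C : ι → Set K)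
    (hC : ∀ i, IsClosed (C i))
    (hf : ∀ x, ∀ U ∈ 𝓝 (f x), ∃ i, G x ∈ C i ∧ ∀ y, G y ∈ C i → f y ∈ U) :
    ∃ H : ℕ → C(K, ℝ), PointwiseLimit (fun n x => H n (G x)) f := by
  let _ := metrizableSpaceMetric K
  rcases isEmpty_or_nonempty X with hX | ⟨⟨x₀⟩⟩
  · exact ⟨fun _ => 0, fun x => isEmptyElim x⟩
  have : Nonempty ι := ⟨(hf x₀ univ univ_mem).choose⟩
  obtain ⟨e, he⟩ := exists_surjective_nat ι
  have hv (n : ℕ) (z : K) : ∃ v : ℝ, ∀ x, dist (G x) z < 1 / ((n : ℝ) + 1) → ∀ M ≤ n,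
      (∀ m < M, G x ∉ C (e m) → Disjoint (Metric.ball z (1 / ((n : ℝ) + 1))) (C (e m))) →
      ∃ p, f p = v ∧ ∀ m < M, G x ∈ C (e m) → G p ∈ C (e m) := by
    by_cases hB : (G ⁻¹' Metric.ball z (1 / ((n : ℝ) + 1))).Nonempty
    · obtain ⟨p, -, hp⟩ := exists_greedy_mem n (fun m => G ⁻¹' C (e m)) _ hB
      exact ⟨f p, fun x hx M hM h => ⟨p, rfl, hp x hx M hM fun m hm hxm =>
        (h m hm hxm).preimage G⟩⟩
    · exact ⟨0, fun x hx => absurd ⟨x, hx⟩ hB⟩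
  choose v hv using hv
  have hH (n : ℕ) : ∃ H : C(K, ℝ), ∀ y, H y ∈
      convexHull ℝ {w | ∃ z, dist y z < 1 / ((n : ℝ) + 1) ∧ v n z = w} := by
    refine exists_continuous_forall_mem_convex_of_local_const (fun y => convex_convexHull ℝ _)
      fun y => ⟨v n y, ?_⟩
    filter_upwards [Metric.ball_mem_nhds y (Nat.one_div_pos_of_nat (α := ℝ) (n := n))] with z hz
    exact subset_convexHull ℝ _ ⟨y, hz, rfl⟩
  choose H hH using hH
  refine ⟨H, fun x => Metric.tendsto_nhds.2 fun ε hε => ?_⟩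
  obtain ⟨i, hxi, hi⟩ := hf x _ (Metric.ball_mem_nhds (f x) hε)
  obtain ⟨m₀, rfl⟩ := he i
  have hnear : ∀ᶠ y in 𝓝 (G x), ∀ m ∈ Set.Iio (m₀ + 1), G x ∉ C (e m) → y ∉ C (e m) := by
    refine (eventually_all_finite (Set.finite_Iio _)).2 fun m _ => ?_
    by_cases hm : G x ∈ C (e m)
    · exact Eventually.of_forall fun y h => absurd hm h
    · filter_upwards [(hC (e m)).isOpen_compl.mem_nhds hm] with y hy _ using hy
  obtain ⟨δ, hδ, hball⟩ := Metric.eventually_nhds_iff.1 hnear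
  have hsmall : ∀ᶠ n : ℕ in atTop, 1 / ((n : ℝ) + 1) < δ / 2 :=
    tendsto_one_div_add_atTop_nhds_zero_nat.eventually_lt_const (half_pos hδ)
  filter_upwards [hsmall, eventually_ge_atTop (m₀ + 1)] with n hn hnm
  refine convexHull_min ?_ (convex_ball (f x) ε) (hH n (G x))
  rintro _ ⟨z, hz, rfl⟩
  obtain ⟨p, hpv, hp⟩ := hv n z x hz (m₀ + 1) hnm fun m hm hxm => by
    refine Set.disjoint_left.2 fun y hy => hball ?_ m hm hxm
    have := dist_triangle_right y (G x) z
    rw [Metric.mem_ball] at hy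
    linarith
  exact hpv ▸ hi p (hp m₀ (Nat.lt_succ_self _) hxi)

/-- The preimage of a closed subset of a metrizable space is a zero-set. -/
theorem isZeroSet_preimage {X : Type u} [TopologicalSpace X] {M : Type*} [TopologicalSpace M]
    [MetrizableSpace M] {φ : X → M} (hφ : Continuous φ) {C : Set M} (hC : IsClosed C) :
    IsZeroSet (φ ⁻¹' C) := by
  let _ := metrizableSpaceMetric M
  rcases C.eq_empty_or_nonempty with rfl | hne
  · exact ⟨fun _ => 1, continuous_const, by ext; simp⟩
  · refine ⟨fun x => Metric.infDist (φ x) C, (Metric.continuous_infDist_pt C).comp hφ, ?_⟩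
    ext x
    exact hC.mem_iff_infDist_zero hne

/-- A zero-set is the zero-set of a function into the unit interval. -/
theorem IsZeroSet.exists_unitInterval {X : Type u} [TopologicalSpace X] {Z : Set X}
    (hZ : IsZeroSet Z) : ∃ g : X → unitInterval, Continuous g ∧ ∀ x, x ∈ Z ↔ g x = 0 := by
  obtain ⟨g, hg, rfl⟩ := hZ
  refine ⟨fun x => ⟨min |g x| 1, le_min (abs_nonneg _) zero_le_one, min_le_right _ _⟩,
    by fun_prop, fun x => ?_⟩
  rw [Subtype.ext_iff]
  simp only [mem_preimage, mem_singleton_iff, Set.Icc.coe_zero]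
  rw [min_eq_iff]
  simp +contextual

theorem isZeroSet_le_of_mem_USCf {X : Type u} [TopologicalSpace X] {f : X → ℝ}
    (hf : f ∈ USCf X) (r : ℝ) : IsZeroSet {x | r ≤ f x} := by
  have := hf r
  rwa [IsCozeroSet, compl_ofPred, show {x | ¬ f x < r} = {x | r ≤ f x} by simp] at this

theorem Continuous.mem_USCf {X : Type u} [TopologicalSpace X] {f : X → ℝ} (hf : Continuous f) :
    f ∈ USCf X := fun _ => isZeroSet_preimage hf isOpen_Iio.isClosed_compl

theorem IsZeroSet.indicator_mem_USCf {X : Type u} [TopologicalSpace X] {Z : Set X}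
    (hZ : IsZeroSet Z) : Z.indicator (fun _ => (1 : ℝ)) ∈ USCf X := by
  classical
  obtain ⟨g, hg, rfl⟩ := hZ
  intro r
  have hr : {x | (g ⁻¹' {0}).indicator (fun _ => (1 : ℝ)) x < r}ᶜ =
      {x | r ≤ 0 ∨ r ≤ 1 ∧ g x = 0} := by
    ext x
    by_cases hx : g x = 0 <;> simp [Set.indicator_apply, hx]
    intro h
    linarith
  rw [IsCozeroSet, hr]
  refine isZeroSet_preimage hg (C := {t | r ≤ 0 ∨ r ≤ 1 ∧ t = 0}) ?_
  exact isClosed_const.union (isClosed_const.inter (isClosed_eq continuous_id continuous_const))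

theorem USCf_subset_B1 (X : Type u) [TopologicalSpace X] : USCf X ⊆ B1 X := by
  intro f hf
  choose g hg hgf using fun r : ℚ => (isZeroSet_le_of_mem_USCf hf r).exists_unitInterval
  let C (i : ℚ × ℚ × ℕ) : Set (ℚ → unitInterval) :=
    {y | y i.1 = 0 ∧ 1 / ((i.2.2 : ℝ) + 1) ≤ (y i.2.1 : ℝ)}
  have hC (i : ℚ × ℚ × ℕ) : IsClosed (C i) :=
    IsClosed.inter (isClosed_eq (by fun_prop) continuous_const)
      (isClosed_le (g := fun y : ℚ → unitInterval => (y i.2.1 : ℝ)) continuous_const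
        (by fun_prop))
  have hfC (x : X) (U : Set ℝ) (hU : U ∈ 𝓝 (f x)) :
      ∃ i, (fun r => g r x) ∈ C i ∧ ∀ y, (fun r => g r y) ∈ C i → f y ∈ U := by
    obtain ⟨ε, hε, hεU⟩ := Metric.mem_nhds_iff.1 hU
    obtain ⟨a, ha, hax⟩ := exists_rat_btwn (sub_lt_self (f x) hε)
    obtain ⟨b, hxb, hb⟩ := exists_rat_btwn (lt_add_of_pos_right (f x) hε)
    have hpos : (0 : ℝ) < g b x := by
      refine lt_of_le_of_ne (g b x).2.1 fun h => hxb.not_ge ((hgf b x).2 (Subtype.ext h.symm))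
    obtain ⟨n, hn⟩ := exists_nat_one_div_lt hpos
    refine ⟨⟨a, b, n⟩, ⟨(hgf a x).1 hax.le, hn.le⟩, fun y hy => hεU ?_⟩
    have hay : (a : ℝ) ≤ f y := (hgf a y).2 hy.1
    have hyb : f y < b := by
      by_contra! h
      have h2 := hy.2
      simp only [(hgf b y).1 h, Set.Icc.coe_zero] at h2
      exact (Nat.one_div_pos_of_nat (α := ℝ) (n := n)).not_ge h2
    rw [Metric.mem_ball, Real.dist_eq, abs_lt]
    constructor <;> linarith
  obtain ⟨H, hH⟩ := exists_continuousMap_pointwiseLimit (fun x r => g r x) f C hC hfC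
  exact ⟨_, fun n => (H n).continuous.comp (continuous_pi hg), hH⟩

/-- If every zero-set of `X` is a countable union of preimages of closed sets under a continuous
map into a compact metrizable space, then the Baire one functions are the sequential closure of a
countable set of continuous functions. -/
theorem exists_countable_seqDense_B1 {X : Type u} [TopologicalSpace X] {K : Type*}
    [TopologicalSpace K] [CompactSpace K] [MetrizableSpace K] {G : X → K} (hG : Continuous G)
    (hZ : ∀ Z : Set X, IsZeroSet Z →
      ∃ C : ℕ → Set K, (∀ n, IsClosed (C n)) ∧ Z = ⋃ n, G ⁻¹' C n) :
    ∃ S : Set (X → ℝ), S.Countable ∧ (∀ f ∈ S, Continuous f) ∧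
      ∀ f ∈ B1 X, ∃ g : ℕ → X → ℝ, (∀ n, g n ∈ S) ∧ PointwiseLimit g f := by
  let _ := metrizableSpaceMetric K
  obtain ⟨D, hDc, hD⟩ := TopologicalSpace.exists_countable_dense C(K, ℝ)
  refine ⟨(fun h : C(K, ℝ) => h ∘ G) '' D, hDc.image _, ?_, ?_⟩
  · rintro _ ⟨h, -, rfl⟩
    exact h.continuous.comp hG
  rintro f ⟨g, hg, hgf⟩
  have hzero (i : ℚ × ℚ × ℕ) : IsZeroSet {x | ∀ k ≥ i.2.2, g k x ∈ Icc (i.1 : ℝ) i.2.1} := by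
    refine isZeroSet_preimage (continuous_pi hg)
      (C := {y : ℕ → ℝ | ∀ k ≥ i.2.2, y k ∈ Icc (i.1 : ℝ) i.2.1}) ?_
    simp only [ofPred_forall]
    exact isClosed_iInter fun k => isClosed_iInter fun _ =>
      isClosed_Icc.preimage (continuous_apply k)
  choose C hC hCZ using fun i => hZ _ (hzero i)
  have hf (x : X) (U : Set ℝ) (hU : U ∈ 𝓝 (f x)) : ∃ i : (ℚ × ℚ × ℕ) × ℕ, G x ∈ C i.1 i.2 ∧
      ∀ y, G y ∈ C i.1 i.2 → f y ∈ U := by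
    obtain ⟨ε, hε, hεU⟩ := Metric.mem_nhds_iff.1 hU
    obtain ⟨a, ha, hax⟩ := exists_rat_btwn (sub_lt_self (f x) hε)
    obtain ⟨b, hxb, hb⟩ := exists_rat_btwn (lt_add_of_pos_right (f x) hε)
    obtain ⟨N, hN⟩ := eventually_atTop.1 ((hgf x).eventually (Icc_mem_nhds hax hxb))
    have hx : x ∈ ⋃ n, G ⁻¹' C (a, b, N) n := hCZ (a, b, N) ▸ hN
    obtain ⟨m, hm⟩ := mem_iUnion.1 hx
    refine ⟨((a, b, N), m), hm, fun y hy => hεU ?_⟩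
    have hy' : y ∈ {x | ∀ k ≥ N, g k x ∈ Icc (a : ℝ) b} :=
      (hCZ (a, b, N)).symm ▸ mem_iUnion.2 ⟨m, hy⟩
    have hfy : f y ∈ Icc (a : ℝ) b :=
      isClosed_Icc.mem_of_tendsto (hgf y) (eventually_atTop.2 ⟨N, hy'⟩)
    rw [Metric.mem_ball, Real.dist_eq, abs_lt]
    constructor <;> linarith [hfy.1, hfy.2]
  obtain ⟨H, hH⟩ := exists_continuousMap_pointwiseLimit G f
    (fun i : (ℚ × ℚ × ℕ) × ℕ => C i.1 i.2) (fun i => hC _ _) hf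
  choose h hhD hh using fun n : ℕ =>
    hD.exists_dist_lt (H n) (Nat.one_div_pos_of_nat (α := ℝ) (n := n))
  refine ⟨fun n => h n ∘ G, fun n => ⟨h n, hhD n, rfl⟩, fun x => ?_⟩
  refine (hH x).congr_dist (squeeze_zero (fun _ => dist_nonneg) (fun n => ?_)
    tendsto_one_div_add_atTop_nhds_zero_nat)
  exact (ContinuousMap.dist_apply_le_dist (G x)).trans (hh n).le

/-- For a Tychonoff space `X`, `USC^f(X)` is sequentially separable iff there is a
countable set `S` of continuous functions on `X` with `[S]_seq = B₁(X)`. -/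
theorem stmt19 (X : Type u) [TopologicalSpace X] [T2Space X] [CompletelyRegularSpace X] :
    SeqSeparable (USCf X) ↔
    ∃ S : Set (X → ℝ), S.Countable ∧ (∀ f ∈ S, Continuous f) ∧
      ∀ f ∈ B1 X, ∃ g : ℕ → X → ℝ, (∀ n, g n ∈ S) ∧ PointwiseLimit g f := by
  constructor
  · rintro ⟨S, hSU, hSc, hS⟩
    have : Countable S := hSc
    choose g hg hgs using fun s : S =>
      (isZeroSet_le_of_mem_USCf (hSU s.2) (1 / 2)).exists_unitInterval
    refine exists_countable_seqDense_B1 (G := fun x s => g s x) (continuous_pi hg)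
      fun Z hZ => ?_
    obtain ⟨s, hsS, hs⟩ := hS _ hZ.indicator_mem_USCf
    refine ⟨fun N => {y | ∀ n ≥ N, y ⟨s n, hsS n⟩ = 0}, fun N => ?_, ?_⟩
    · simp only [ofPred_forall]
      exact isClosed_iInter fun n => isClosed_iInter fun _ =>
        isClosed_eq (continuous_apply _) continuous_const
    ext x
    simp only [mem_iUnion, mem_preimage, mem_ofPred_eq, ← hgs]
    have hx := hs x
    constructor
    · intro hxZ
      rw [indicator_of_mem hxZ] at hx
      exact eventually_atTop.1 (hx.eventually_const_le (by norm_num))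
    · rintro ⟨N, hN⟩
      by_contra hxZ
      rw [indicator_of_notMem hxZ] at hx
      have := ge_of_tendsto hx (eventually_atTop.2 ⟨N, hN⟩)
      norm_num at this
  · rintro ⟨S, hSc, hcont, hS⟩
    exact ⟨S, fun f hf => (hcont f hf).mem_USCf, hSc, fun f hf => hS f (USCf_subset_B1 X hf)⟩
end
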